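/- arXiv:2011.13790 — 6 statements merged into one kernel-verified Lean document; each statement's English description precedes it below -/
import Mathlib

section
/- Let v_1,…,v_8 be unit vectors in ℂ^3 such that v_1 ⊥ v_2, v_1 ⊥ v_8, {v_2,v_3,v_4} is an orthonormal basis, {v_6,v_7,v_8} is an orthonormal basis, v_3 ⊥ v_7, v_4 ⊥ v_5, and v_5 ⊥ v_6 (the orthogonality structure of Kochen and Specker's 'bug'). Then every KS assignment f of S = {v_1,…,v_8} satisfies f(v_1) + f(v_5) ≤ 1; that is, S is a true-implies-false set between v_1 and v_5. -/
open BigOperators Finset Matrix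

/-- Kochen–Specker's "bug". Let `v 0, …, v 7` be unit vectors in `ℂ^3`
(playing the roles of `v_1, …, v_8`) with `v_1 ⊥ v_2`, `v_1 ⊥ v_8`, `{v_2,v_3,v_4}` and
`{v_6,v_7,v_8}` orthonormal bases, `v_3 ⊥ v_7`, `v_4 ⊥ v_5`, `v_5 ⊥ v_6`. Then every KS
assignment `f` (a 0/1 assignment such that no two orthogonal vectors are both assigned 1
and among any 3 mutually orthogonal vectors one is assigned 1) satisfies
`f(v_1) + f(v_5) ≤ 1`; i.e. the set is a true-implies-false set between `v_1` and `v_5`. -/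
theorem statement8
    (v : Fin 8 → (Fin 3 → ℂ))
    (hunit : ∀ i, star (v i) ⬝ᵥ v i = 1)
    (h12 : star (v 0) ⬝ᵥ v 1 = 0)
    (h18 : star (v 0) ⬝ᵥ v 7 = 0)
    (h23 : star (v 1) ⬝ᵥ v 2 = 0)
    (h24 : star (v 1) ⬝ᵥ v 3 = 0)
    (h34 : star (v 2) ⬝ᵥ v 3 = 0)
    (h67 : star (v 5) ⬝ᵥ v 6 = 0)
    (h68 : star (v 5) ⬝ᵥ v 7 = 0)
    (h78 : star (v 6) ⬝ᵥ v 7 = 0)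
    (h37 : star (v 2) ⬝ᵥ v 6 = 0)
    (h45 : star (v 3) ⬝ᵥ v 4 = 0)
    (h56 : star (v 4) ⬝ᵥ v 5 = 0)
    (f : Fin 8 → ℕ)
    (hf01 : ∀ i, f i = 0 ∨ f i = 1)
    (hfI : ∀ i j, star (v i) ⬝ᵥ v j = 0 → ¬(f i = 1 ∧ f j = 1))
    (hfII : ∀ i j k, star (v i) ⬝ᵥ v j = 0 → star (v i) ⬝ᵥ v k = 0 →
      star (v j) ⬝ᵥ v k = 0 → f i = 1 ∨ f j = 1 ∨ f k = 1) :
    f 0 + f 4 ≤ 1 := by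
  have n12 := hfI 0 1 h12
  have n18 := hfI 0 7 h18
  have n37 := hfI 2 6 h37
  have n45 := hfI 3 4 h45
  have n56 := hfI 4 5 h56
  have basis234 := hfII 1 2 3 h23 h24 h34
  have basis678 := hfII 5 6 7 h67 h68 h78
  have f0 := hf01 0
  have f4 := hf01 4
  omega
end

section
/- Let S be a finite set of unit vectors in ℂ^3 containing four pairwise disjoint orthonormal bases B_0 = {u_1, u_2, u_3}, B_1, B_2, B_3. Suppose that for every KS assignment f of S, for every i ∈ {1,2,3} and every v ∈ B_i one has f(u_i) + f(v) ≤ 1 (i.e., within S there is a TIFS between u_i and every element of B_i). Then S admits no KS assignment, i.e., S is a KS set. -/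
open BigOperators Finset Matrix

/-- A KS assignment for a finite set `S` of vectors in `ℂ^3`: a 0/1 assignment such that
(I) no two orthogonal vectors of `S` are both assigned 1, and (II) among any 3 mutually
orthogonal vectors of `S` at least one is assigned 1. -/
def IsKSAssignment3 (S : Finset (Fin 3 → ℂ)) (f : (Fin 3 → ℂ) → ℕ) : Prop :=
  (∀ u ∈ S, f u = 0 ∨ f u = 1) ∧
  (∀ u ∈ S, ∀ w ∈ S, star u ⬝ᵥ w = 0 → ¬(f u = 1 ∧ f w = 1)) ∧
  (∀ b : Fin 3 → (Fin 3 → ℂ), (∀ k, b k ∈ S) →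
    (∀ k l, k ≠ l → star (b k) ⬝ᵥ b l = 0) → ∃ k, f (b k) = 1)

/-- Let `S` be a finite set of unit vectors in `ℂ^3` containing four pairwise
disjoint orthonormal bases `B₀ = {u 0, u 1, u 2}, B 0, B 1, B 2` such that for every KS
assignment `f` of `S`, every `i` and every `x ∈ B i` satisfy `f (u i) + f x ≤ 1` (a TIFS
between `u i` and each element of `B i`). Then `S` admits no KS assignment, i.e. `S` is a
KS set. -/
theorem statement9
    (S : Finset (Fin 3 → ℂ))
    (hunit : ∀ x ∈ S, star x ⬝ᵥ x = (1 : ℂ))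
    (u : Fin 3 → (Fin 3 → ℂ))
    (B : Fin 3 → Finset (Fin 3 → ℂ))
    (hu_mem : ∀ i, u i ∈ S)
    (hu_orth : ∀ i j, i ≠ j → star (u i) ⬝ᵥ u j = 0)
    (hB_sub : ∀ i, B i ⊆ S)
    (hB_card : ∀ i, (B i).card = 3)
    (hB_orth : ∀ i, ∀ x ∈ B i, ∀ y ∈ B i, x ≠ y → star x ⬝ᵥ y = 0)
    (hdisj0 : ∀ i, Disjoint ({u 0, u 1, u 2} : Finset (Fin 3 → ℂ)) (B i))
    (hdisj : ∀ i j, i ≠ j → Disjoint (B i) (B j))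
    (hTIFS : ∀ f : (Fin 3 → ℂ) → ℕ, IsKSAssignment3 S f →
      ∀ i, ∀ x ∈ B i, f (u i) + f x ≤ 1) :
    ¬ ∃ f : (Fin 3 → ℂ) → ℕ, IsKSAssignment3 S f := by
  rintro ⟨f, hf⟩
  obtain ⟨i, hi⟩ := hf.2.2 u hu_mem hu_orth
  let e := (B i).equivFinOfCardEq (hB_card i)
  obtain ⟨k, hk⟩ := hf.2.2 (fun k => (e.symm k : Fin 3 → ℂ))
    (fun k => hB_sub i (e.symm k).2)
    (fun k l hkl => hB_orth i _ (e.symm k).2 _ (e.symm l).2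
      (fun h => hkl (e.symm.injective (Subtype.ext h))))
  have h := hTIFS f hf i _ (e.symm k).2
  omega
end

section
/- For every dimension d ≥ 3 and every pair of linearly independent, nonorthogonal unit vectors a, b ∈ ℂ^d, there exists a finite set S of unit vectors in ℂ^d with a, b ∈ S such that S admits at least one KS assignment and every KS assignment f of S satisfies f(a) + f(b) ≤ 1; that is, there is a true-implies-false set between any two nonorthogonal rays. -/
open BigOperators Finset Matrix

/-- A KS assignment for a finite set `S` of vectors in `ℂ^d`: a 0/1 assignment such that
(I) no two orthogonal vectors of `S` are both assigned 1, and (II) among any `d` mutually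
orthogonal vectors of `S` at least one is assigned 1. -/
def IsKSAssignment (d : ℕ) (S : Finset (Fin d → ℂ)) (f : (Fin d → ℂ) → ℕ) : Prop :=
  (∀ u ∈ S, f u = 0 ∨ f u = 1) ∧
  (∀ u ∈ S, ∀ w ∈ S, star u ⬝ᵥ w = 0 → ¬(f u = 1 ∧ f w = 1)) ∧
  (∀ b : Fin d → (Fin d → ℂ), (∀ k, b k ∈ S) →
    (∀ k l, k ≠ l → star (b k) ⬝ᵥ b l = 0) → ∃ k, f (b k) = 1)

/-- A 0/1 assignment on rays of `ℝ³` obeying the Kochen-Specker rules on `S`. -/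
def IsRealKS (S : Finset (Fin 3 → ℝ)) (f : (Fin 3 → ℝ) → ℕ) : Prop :=
  (∀ u ∈ S, ∀ w ∈ S, u ⬝ᵥ w = 0 → ¬(f u = 1 ∧ f w = 1)) ∧
  (∀ r ∈ S, ∀ p ∈ S, ∀ s ∈ S, r ⬝ᵥ p = 0 → r ⬝ᵥ s = 0 → p ⬝ᵥ s = 0 →
    f r = 1 ∨ f p = 1 ∨ f s = 1)

/-- The squared overlap of the ray of `x` with the unit vector `(0, 5/13, 12/13)`
is less than `1/3` or greater than `1/2`. -/
def AvoidsBand (x : Fin 3 → ℝ) : Prop :=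
  3 * (5 * x 1 + 12 * x 2) ^ 2 < 169 * (x ⬝ᵥ x) ∨ 169 * (x ⬝ᵥ x) < 2 * (5 * x 1 + 12 * x 2) ^ 2

/-- Some finite set of rays avoiding the band forbids assigning 1 to both `u` and `v`. -/
def RealExcludes (u v : Fin 3 → ℝ) : Prop :=
  ∃ S : Finset (Fin 3 → ℝ), (∀ x ∈ S, AvoidsBand x) ∧ u ∈ S ∧ v ∈ S ∧
    ∀ f, IsRealKS S f → ¬(f u = 1 ∧ f v = 1)

lemma IsRealKS.mono {S T : Finset (Fin 3 → ℝ)} {f : (Fin 3 → ℝ) → ℕ} (h : IsRealKS T f)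
    (hST : S ⊆ T) : IsRealKS S f :=
  ⟨fun u hu w hw => h.1 u (hST hu) w (hST hw),
    fun r hr p hp s hs => h.2 r (hST hr) p (hST hp) s (hST hs)⟩

lemma AvoidsBand.dotProduct_self_pos {x : Fin 3 → ℝ} (h : AvoidsBand x) : 0 < x ⬝ᵥ x := by
  have h0 : x ⬝ᵥ x = x 0 ^ 2 + x 1 ^ 2 + x 2 ^ 2 := by
    simp [dotProduct, Fin.sum_univ_three]; ring
  rcases h with h | h
  · nlinarith [sq_nonneg (5 * x 1 + 12 * x 2)]
  · rw [h0] at h ⊢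
    by_contra! hn
    nlinarith [sq_nonneg (12 * x 1 - 5 * x 2), sq_nonneg (x 0), sq_nonneg (x 1), sq_nonneg (x 2)]

lemma IsRealKS.eq_one_of_orthogonal {S : Finset (Fin 3 → ℝ)} {f : (Fin 3 → ℝ) → ℕ}
    (h : IsRealKS S f) {u v r p s : Fin 3 → ℝ} (hu : u ∈ S) (hv : v ∈ S) (hr : r ∈ S)
    (hp : p ∈ S) (hs : s ∈ S) (hrp : r ⬝ᵥ p = 0) (hrs : r ⬝ᵥ s = 0) (hps : p ⬝ᵥ s = 0)
    (hup : u ⬝ᵥ p = 0) (hvs : v ⬝ᵥ s = 0) (hfu : f u = 1) (hfv : f v = 1) : f r = 1 := by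
  rcases h.2 r hr p hp s hs hrp hrs hps with h1 | h1 | h1
  · exact h1
  · exact absurd ⟨hfu, h1⟩ (h.1 u hu p hp hup)
  · exact absurd ⟨hfv, h1⟩ (h.1 v hv s hs hvs)

lemma RealExcludes.of_orthogonal {u v : Fin 3 → ℝ} (hu : AvoidsBand u) (hv : AvoidsBand v)
    (huv : u ⬝ᵥ v = 0) : RealExcludes u v := by
  classical
  refine ⟨{u, v}, ?_, by simp, by simp, fun f hf => hf.1 u (by simp) v (by simp) huv⟩
  simp [hu, hv]

lemma RealExcludes.step {u v r r' p p' s s' : Fin 3 → ℝ} (h : RealExcludes r r')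
    (hu : AvoidsBand u) (hv : AvoidsBand v) (hp : AvoidsBand p) (hs : AvoidsBand s)
    (hp' : AvoidsBand p') (hs' : AvoidsBand s')
    (hrp : r ⬝ᵥ p = 0) (hrs : r ⬝ᵥ s = 0) (hps : p ⬝ᵥ s = 0)
    (hup : u ⬝ᵥ p = 0) (hvs : v ⬝ᵥ s = 0)
    (hrp' : r' ⬝ᵥ p' = 0) (hrs' : r' ⬝ᵥ s' = 0) (hps' : p' ⬝ᵥ s' = 0)
    (hup' : u ⬝ᵥ p' = 0) (hvs' : v ⬝ᵥ s' = 0) : RealExcludes u v := by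
  classical
  obtain ⟨S, hS, hr, hr', hf⟩ := h
  refine ⟨{u, v, p, s, p', s'} ∪ S, ?_, by simp, by simp, ?_⟩
  · intro x hx
    simp only [Finset.mem_union, Finset.mem_insert, Finset.mem_singleton] at hx
    rcases hx with (rfl | rfl | rfl | rfl | rfl | rfl) | hx <;> first | assumption | exact hS x hx
  · rintro f hKS ⟨hfu, hfv⟩
    exact hf f (hKS.mono Finset.subset_union_right)
      ⟨hKS.eq_one_of_orthogonal (u := u) (v := v) (p := p) (s := s) (by simp) (by simp)
          (by simp [hr]) (by simp) (by simp) hrp hrs hps hup hvs hfu hfv,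
        hKS.eq_one_of_orthogonal (u := u) (v := v) (p := p') (s := s') (by simp) (by simp)
          (by simp [hr']) (by simp) (by simp) hrp' hrs' hps' hup' hvs' hfu hfv⟩

lemma realExcludes_one : RealExcludes ![√1, 1, 0] ![√1, -1, 0] := by
  apply RealExcludes.of_orthogonal <;>
    simp [AvoidsBand, dotProduct, Fin.sum_univ_three] <;> norm_num

lemma sqrt_sub_one_bounds {w : ℝ} (hw : 2 ≤ w) :
    √w ^ 2 = w ∧ √(w - 1) ^ 2 = w - 1 ∧ √(w - 1) ≤ √w ∧ 7 * √w ≤ 10 * √(w - 1) ∧ 1 ≤ √w := by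
  have h1 : √w ^ 2 = w := Real.sq_sqrt (by linarith)
  have h2 : √(w - 1) ^ 2 = w - 1 := Real.sq_sqrt (by linarith)
  have h3 := Real.sqrt_nonneg w
  have h4 := Real.sqrt_nonneg (w - 1)
  refine ⟨h1, h2, Real.sqrt_le_sqrt (by linarith), ?_, ?_⟩ <;> nlinarith

lemma RealExcludes.even_step {w : ℝ} (hw : 2 ≤ w)
    (h : RealExcludes ![√(w - 1), 1, 0] ![√(w - 1), -1, 0]) :
    RealExcludes ![√w, 0, 1] ![√w, 0, -1] := by
  obtain ⟨h1, h2, h3, h4, h5⟩ := sqrt_sub_one_bounds hw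
  set x := √w
  set y := √(w - 1)
  refine h.step (p := ![1, -y, -x]) (s := ![1, -y, x]) (p' := ![1, y, -x]) (s' := ![1, y, x])
    (Or.inl ?_) (Or.inl ?_) (Or.inr ?_) (Or.inl ?_) (Or.inl ?_) (Or.inr ?_)
    ?_ ?_ ?_ ?_ ?_ ?_ ?_ ?_ ?_ ?_ <;>
    simp [dotProduct, Fin.sum_univ_three] <;> nlinarith

lemma RealExcludes.odd_step {w : ℝ} (hw : 2 ≤ w)
    (h : RealExcludes ![√(w - 1), 0, 1] ![√(w - 1), 0, -1]) :
    RealExcludes ![√w, 1, 0] ![√w, -1, 0] := by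
  obtain ⟨h1, h2, h3, h4, h5⟩ := sqrt_sub_one_bounds hw
  set x := √w
  set y := √(w - 1)
  refine h.step (p := ![1, -x, -y]) (s := ![1, x, -y]) (p' := ![1, -x, y]) (s' := ![1, x, y])
    (Or.inl ?_) (Or.inl ?_) (Or.inr ?_) (Or.inl ?_) (Or.inl ?_) (Or.inr ?_)
    ?_ ?_ ?_ ?_ ?_ ?_ ?_ ?_ ?_ ?_ <;>
    simp [dotProduct, Fin.sum_univ_three] <;> nlinarith

lemma realExcludes_even (m : ℕ) :
    RealExcludes ![√(2 * m + 2 : ℝ), 0, 1] ![√(2 * m + 2 : ℝ), 0, -1] := by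
  induction m with
  | zero =>
    apply RealExcludes.even_step (by simp)
    have : (2 * ((0 : ℕ) : ℝ) + 2 - 1) = 1 := by norm_num
    rw [this]
    exact realExcludes_one
  | succ m ih =>
    have hm : (0 : ℝ) ≤ m := m.cast_nonneg
    apply RealExcludes.even_step (by push_cast; linarith)
    apply RealExcludes.odd_step (by push_cast; linarith)
    have : (2 * ((m + 1 : ℕ) : ℝ) + 2 - 1 - 1) = 2 * m + 2 := by push_cast; ring
    rw [this]
    exact ih

lemma abs_mul_le_of_abs_le {X Y c : ℝ} (h : |X| ≤ c * |Y|) : |X * Y| ≤ c * Y ^ 2 := by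
  rw [abs_mul, ← sq_abs Y]
  nlinarith [abs_nonneg Y]

lemma sq_le_of_abs_le {X Y c : ℝ} (h : |X| ≤ c * |Y|) : X ^ 2 ≤ c ^ 2 * Y ^ 2 := by
  rw [← sq_abs X, ← sq_abs Y, ← mul_pow]
  exact pow_le_pow_left₀ (abs_nonneg X) h 2

lemma RealExcludes.planar {k a₀ a₁ b₀ b₁ σ : ℝ} (hk : 0 ≤ k)
    (h : RealExcludes ![k, 0, 1] ![k, 0, -1])
    (ha : a₀ ^ 2 + a₁ ^ 2 = 1) (hb : b₀ ^ 2 + b₁ ^ 2 = 1)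
    (hab : a₀ * b₀ + (k ^ 2 + 1) * (a₁ * b₁) = 0)
    (hσ1 : σ ≤ 1) (hkσ : 100 ≤ k * σ) (hσb : σ ≤ |b₁|)
    (ha₁ : |a₁| * (k ^ 2 * σ) ≤ 1) :
    RealExcludes ![a₀, a₁, 0] ![b₀, b₁, 0] := by
  have hk1 : 100 ≤ k := by nlinarith
  have hak : |a₁| * k ≤ 1 / 100 := by
    nlinarith [mul_nonneg (abs_nonneg a₁) hk]
  have ha₁' : |a₁| ≤ 1 / 10000 := by nlinarith [abs_nonneg a₁]
  have ha₀ : 99 / 100 ≤ |a₀| := by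
    rw [← sq_abs a₀, ← sq_abs a₁] at ha
    nlinarith [abs_nonneg a₀, abs_nonneg a₁]
  have hb₀ : |b₀| ≤ 1 := by
    rw [← sq_abs b₀, ← sq_abs b₁] at hb
    nlinarith [abs_nonneg b₀, abs_nonneg b₁]
  have hX : |(k ^ 2 + 1) * a₁| ≤ 12 / 1000 * |k * a₀| := by
    rw [abs_mul, abs_mul, abs_of_nonneg hk, abs_of_nonneg (by positivity : 0 ≤ k ^ 2 + 1)]
    nlinarith [mul_le_mul_of_nonneg_left ha₀ hk, mul_le_mul_of_nonneg_right hak hk]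
  have hZ : |k * b₀| ≤ 1 / 100 * |(k ^ 2 + 1) * b₁| := by
    rw [abs_mul, abs_mul, abs_of_nonneg hk, abs_of_nonneg (by positivity : 0 ≤ k ^ 2 + 1)]
    have h1 : 100 ≤ k * |b₁| := hkσ.trans (mul_le_mul_of_nonneg_left hσb hk)
    nlinarith [mul_le_mul_of_nonneg_left hb₀ hk, mul_le_mul_of_nonneg_left h1 hk, abs_nonneg b₁]
  have hX1 := abs_le.1 (abs_mul_le_of_abs_le hX)
  have hX2 := sq_le_of_abs_le hX
  have hZ1 := abs_le.1 (abs_mul_le_of_abs_le hZ)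
  have hZ2 := sq_le_of_abs_le hZ
  have hY : 1 / 2 ≤ (k * a₀) ^ 2 := by
    have h1 : 1 ≤ k * |a₀| := by nlinarith
    rw [← sq_abs, abs_mul, abs_of_nonneg hk]
    nlinarith
  have ha₀2 : 10000 * a₀ ^ 2 ≤ (k * a₀) ^ 2 := by
    rw [mul_pow]
    exact mul_le_mul_of_nonneg_right (by nlinarith) (sq_nonneg _)
  have hW : 0 < ((k ^ 2 + 1) * b₁) ^ 2 := by
    have : 0 < |b₁| := lt_of_lt_of_le (by nlinarith) hσb
    have : b₁ ≠ 0 := abs_pos.1 this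
    positivity
  refine h.step (p := ![b₀, (k ^ 2 + 1) * b₁, -(k * b₀)]) (s := ![a₀, (k ^ 2 + 1) * a₁, -(k * a₀)])
    (p' := ![b₀, (k ^ 2 + 1) * b₁, k * b₀]) (s' := ![a₀, (k ^ 2 + 1) * a₁, k * a₀])
    (Or.inl ?_) (Or.inl ?_) (Or.inl ?_) (Or.inr ?_) (Or.inl ?_) (Or.inr ?_)
    ?_ ?_ ?_ ?_ ?_ ?_ ?_ ?_ ?_ ?_ <;>
    simp only [dotProduct, Fin.sum_univ_three, Matrix.cons_val]
  · linarith [sq_nonneg a₀, sq_nonneg a₁]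
  · linarith [sq_nonneg b₀, sq_nonneg b₁]
  · linarith [sq_nonneg b₀]
  · linarith
  · linarith [sq_nonneg b₀]
  · linarith
  · ring
  · ring
  · linear_combination (k ^ 2 + 1) * hab
  · linear_combination hab
  · linear_combination hab
  · ring
  · ring
  · linear_combination (k ^ 2 + 1) * hab
  · linear_combination hab
  · linear_combination hab

lemma exists_realExcludes {C : ℝ} (hC0 : 0 < C) (hC1 : C < 1) :
    ∃ a₀ a₁ b₀ b₁ : ℝ, a₀ ^ 2 + a₁ ^ 2 = 1 ∧ b₀ ^ 2 + b₁ ^ 2 = 1 ∧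
      a₀ * b₀ + a₁ * b₁ = C ∧ a₀ * b₁ - a₁ * b₀ = √(1 - C ^ 2) ∧
      RealExcludes ![a₀, a₁, 0] ![b₀, b₁, 0] := by
  set γ := Real.arccos C with hγ
  have hγ0 : 0 < γ := Real.arccos_pos.2 hC1
  have hγ1 : γ < Real.pi / 2 := Real.arccos_lt_pi_div_two.2 hC0
  set σ := Real.sin (γ / 2) with hσdef
  have hσ : 0 < σ := Real.sin_pos_of_pos_of_lt_pi (by linarith) (by linarith)
  have hσ1 : σ ≤ 1 := Real.sin_le_one _
  have hcosγ : Real.cos γ = C := Real.cos_arccos (by linarith) hC1.le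
  have hCσ : 1 - C = 2 * σ ^ 2 := by
    have := Real.cos_two_mul (γ / 2)
    have h2 := Real.sin_sq_add_cos_sq (γ / 2)
    rw [mul_div_cancel₀ _ (two_ne_zero)] at this
    rw [← hcosγ, this, hσdef]; linarith
  obtain ⟨m, hm⟩ := exists_nat_gt (10000 / σ ^ 2)
  set n : ℝ := 2 * m + 2 with hn
  have hnσ : 10000 ≤ n * σ ^ 2 := by
    rw [div_lt_iff₀ (by positivity)] at hm
    nlinarith [sq_nonneg σ, (m.cast_nonneg : (0 : ℝ) ≤ m)]
  have hn0 : 0 < n := by positivity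
  have hcos : C * (n + 2) / n ≤ 1 := by
    rw [div_le_one hn0]; nlinarith
  set δ := Real.arccos (C * (n + 2) / n) with hδ
  have hδ0 : 0 ≤ δ := Real.arccos_nonneg _
  have hδγ : δ ≤ γ := Real.arccos_le_arccos (by rw [le_div_iff₀ hn0]; nlinarith)
  have hcosδ : Real.cos δ = C * (n + 2) / n :=
    Real.cos_arccos (le_trans (by norm_num) (by positivity : 0 ≤ C * (n + 2) / n)) hcos
  set α := (δ - γ) / 2 with hα
  set β := (δ + γ) / 2 with hβ
  have hsub : Real.cos α * Real.cos β + Real.sin α * Real.sin β = C := by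
    rw [← Real.cos_sub, ← hcosγ, ← Real.cos_neg γ]; congr 1; rw [hα, hβ]; ring
  have hadd : Real.cos α * Real.cos β - Real.sin α * Real.sin β = C * (n + 2) / n := by
    rw [← Real.cos_add, ← hcosδ]; congr 1; rw [hα, hβ]; ring
  have hss : Real.sin α * Real.sin β = -C / n := by
    have : C * (n + 2) / n = C + 2 * (C / n) := by field_simp
    rw [this] at hadd; rw [neg_div]; linarith
  have hσβ : σ ≤ Real.sin β :=
    Real.sin_le_sin_of_le_of_le_pi_div_two (by linarith) (by linarith) (by linarith)
  have hsq : √n ^ 2 = n := Real.sq_sqrt hn0.le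
  refine ⟨Real.cos α, Real.sin α, Real.cos β, Real.sin β, Real.cos_sq_add_sin_sq α,
    Real.cos_sq_add_sin_sq β, hsub, ?_, ?_⟩
  · rw [← Real.sin_arccos, ← hγ]
    have : γ = β - α := by rw [hα, hβ]; ring
    rw [this, Real.sin_sub]; ring
  · apply (realExcludes_even m).planar (Real.sqrt_nonneg _) (Real.cos_sq_add_sin_sq α)
      (Real.cos_sq_add_sin_sq β) (σ := σ) _ hσ1 _ (hσβ.trans (le_abs_self _))
    · rw [hsq]
      have h1 : |Real.sin α| * |Real.sin β| = C / n := by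
        rw [← abs_mul, hss, neg_div, abs_neg, abs_of_nonneg (by positivity)]
      rw [abs_of_nonneg (hσ.le.trans hσβ)] at h1
      have h2 : |Real.sin α| * σ ≤ C / n :=
        h1 ▸ mul_le_mul_of_nonneg_left hσβ (abs_nonneg _)
      rw [le_div_iff₀ hn0] at h2
      linarith
    · rw [hsq]
      have : n * (C / n) = C := by field_simp
      rw [neg_div] at hss
      linear_combination hsub + n * hss - this
    · refine le_of_sq_le_sq ?_ (by positivity)
      rw [mul_pow, hsq]; linarith

lemma star_dotProduct_eq_inner {d : ℕ} (x y : Fin d → ℂ) :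
    star x ⬝ᵥ y = inner ℂ (WithLp.toLp 2 x) (WithLp.toLp 2 y) := by
  rw [EuclideanSpace.inner_toLp_toLp, dotProduct_comm]

lemma star_dotProduct_eq_zero_comm {d : ℕ} {x y : Fin d → ℂ} :
    star x ⬝ᵥ y = 0 ↔ star y ⬝ᵥ x = 0 := by
  rw [star_dotProduct_eq_inner, star_dotProduct_eq_inner, inner_eq_zero_symm]

lemma norm_star_dotProduct_comm {d : ℕ} (x y : Fin d → ℂ) :
    ‖star x ⬝ᵥ y‖ = ‖star y ⬝ᵥ x‖ := by
  rw [star_dotProduct_eq_inner, star_dotProduct_eq_inner, norm_inner_symm]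

lemma star_dotProduct_self_eq_norm_sq {d : ℕ} (x : Fin d → ℂ) :
    star x ⬝ᵥ x = ((‖WithLp.toLp 2 x‖ ^ 2 : ℝ) : ℂ) := by
  rw [star_dotProduct_eq_inner, inner_self_eq_norm_sq_to_K]
  simp

lemma orthonormal_toLp {d : ℕ} {ι : Type*} {v : ι → Fin d → ℂ}
    (h1 : ∀ i, star (v i) ⬝ᵥ v i = 1) (h0 : ∀ i j, i ≠ j → star (v i) ⬝ᵥ v j = 0) :
    Orthonormal ℂ fun i => WithLp.toLp 2 (v i) := by
  classical
  rw [orthonormal_iff_ite]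
  intro i j
  rw [← star_dotProduct_eq_inner]
  split_ifs with h
  · rw [← h, h1]
  · exact h0 i j h

/-- Coloring the rays whose squared overlap with `e` exceeds `1/2` is a KS assignment, as soon as
no squared overlap lies in `[1/d, 1/2]`. -/
lemma exists_isKSAssignment {d : ℕ} {e : Fin d → ℂ} (he : star e ⬝ᵥ e = 1)
    {S : Finset (Fin d → ℂ)} (hS : ∀ x ∈ S, star x ⬝ᵥ x = 1)
    (hband : ∀ x ∈ S, ‖star e ⬝ᵥ x‖ ^ 2 < 1 / d ∨ 1 / 2 < ‖star e ⬝ᵥ x‖ ^ 2) :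
    ∃ f, IsKSAssignment d S f := by
  classical
  have hnorm : ‖WithLp.toLp 2 e‖ ^ 2 = 1 := by
    rw [star_dotProduct_self_eq_norm_sq] at he
    exact_mod_cast he
  refine ⟨fun x => if 1 / 2 < ‖star e ⬝ᵥ x‖ ^ 2 then 1 else 0, ?_, ?_, ?_⟩
  · intro u _
    dsimp only
    split_ifs <;> simp
  · rintro u hu w hw huw ⟨h1, h2⟩
    have hu' : 1 / 2 < ‖star e ⬝ᵥ u‖ ^ 2 := by
      by_contra h
      simp only [if_neg h, zero_ne_one] at h1
    have hw' : 1 / 2 < ‖star e ⬝ᵥ w‖ ^ 2 := by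
      by_contra h
      simp only [if_neg h, zero_ne_one] at h2
    have hon : Orthonormal ℂ fun i => WithLp.toLp 2 ((![u, w] : Fin 2 → Fin d → ℂ) i) := by
      apply orthonormal_toLp
      · simp [Fin.forall_fin_two, hS u hu, hS w hw]
      · simp [Fin.forall_fin_two, huw, star_dotProduct_eq_zero_comm.1 huw]
    have := hon.sum_inner_products_le (WithLp.toLp 2 e) (s := Finset.univ)
    simp only [Fin.sum_univ_two, hnorm, ← star_dotProduct_eq_inner,
      norm_star_dotProduct_comm _ e, Matrix.cons_val] at this
    linarith
  · intro B hB hB0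
    have hon := orthonormal_toLp (fun k => hS _ (hB k)) hB0
    let b := OrthonormalBasis.mk hon
      (hon.linearIndependent.span_eq_top_of_card_eq_finrank' (by simp)).ge
    have hsum := b.sum_sq_norm_inner_left (WithLp.toLp 2 e)
    simp only [b, OrthonormalBasis.coe_mk, hnorm, ← star_dotProduct_eq_inner] at hsum
    by_contra! hf
    have hlt : ∀ k, ‖star e ⬝ᵥ B k‖ ^ 2 < 1 / d := fun k => by
      refine (hband _ (hB k)).resolve_right fun h => hf k ?_
      simp only [if_pos h]
    rcases Nat.eq_zero_or_pos d with rfl | hd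
    · simp at hsum
    · have : ∑ k, ‖star e ⬝ᵥ B k‖ ^ 2 < ∑ _k : Fin d, (1 / d : ℝ) :=
        Finset.sum_lt_sum_of_nonempty ⟨⟨0, hd⟩, Finset.mem_univ _⟩ fun k _ => hlt k
      rw [hsum] at this
      have hd' : (d : ℝ) ≠ 0 := by positivity
      simp [hd'] at this

lemma exists_frame {n : ℕ} {x y : Fin (n + 3) → ℂ} (hx : star x ⬝ᵥ x = 1)
    (hy : star y ⬝ᵥ y = 1) (hxy : star x ⬝ᵥ y = 0) :
    ∃ g : Fin (n + 3) → Fin (n + 3) → ℂ,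
      (∀ i j, star (g i) ⬝ᵥ g j = if i = j then 1 else 0) ∧ g 0 = x ∧ g 1 = y := by
  classical
  let v : Fin (n + 3) → Fin (n + 3) → ℂ := fun i => if i = 0 then x else y
  have hon : Orthonormal ℂ (({0, 1} : Set (Fin (n + 3))).domRestrict fun i => WithLp.toLp 2 (v i)) := by
    apply orthonormal_toLp (v := fun i : ({0, 1} : Set (Fin (n + 3))) => v i)
    · rintro ⟨i, rfl | rfl⟩ <;> simp [v, hx, hy]
    · rintro ⟨i, rfl | rfl⟩ ⟨j, rfl | rfl⟩ <;>
        simp [v, hxy, star_dotProduct_eq_zero_comm.1 hxy]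
  obtain ⟨b, hb⟩ := hon.exists_orthonormalBasis_extension_of_card_eq (by simp)
  refine ⟨fun i => WithLp.ofLp (b i), fun i j => ?_, ?_, ?_⟩
  · rw [star_dotProduct_eq_inner]
    exact orthonormal_iff_ite.1 b.orthonormal i j
  · simp [hb 0 (by simp), v]
  · simp [hb 1 (by simp), v]

/-- The embedding of `ℝ³` into `ℂ^(n+3)` along the first three vectors of a frame. -/
def frameEmbed {n : ℕ} (g : Fin (n + 3) → Fin (n + 3) → ℂ) (x : Fin 3 → ℝ) : Fin (n + 3) → ℂ :=
  (x 0 : ℂ) • g 0 + (x 1 : ℂ) • g 1 + (x 2 : ℂ) • g 2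

section Frame

variable {n : ℕ} {g : Fin (n + 3) → Fin (n + 3) → ℂ}

lemma star_dotProduct_frameEmbed (hg : ∀ i j, star (g i) ⬝ᵥ g j = if i = j then 1 else 0)
    (x y : Fin 3 → ℝ) : star (frameEmbed g x) ⬝ᵥ frameEmbed g y = ((x ⬝ᵥ y : ℝ) : ℂ) := by
  have h2 : 2 % (n + 3) = 2 := Nat.mod_eq_of_lt (by lia)
  simp only [frameEmbed, star_add, star_smul, dotProduct_add, add_dotProduct, smul_dotProduct,
    dotProduct_smul, hg]
  simp [dotProduct, Fin.sum_univ_three, Fin.ext_iff, h2]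
  ring

lemma star_dotProduct_frameEmbed_of_three_le
    (hg : ∀ i j, star (g i) ⬝ᵥ g j = if i = j then 1 else 0) (k : Fin n) (x : Fin 3 → ℝ) :
    star (g k.succ.succ.succ) ⬝ᵥ frameEmbed g x = 0 := by
  have h2 : 2 % (n + 1 + 1 + 1) = 2 := Nat.mod_eq_of_lt (by lia)
  simp [frameEmbed, hg, dotProduct_add, Fin.ext_iff, h2]

/-- The unit vector with phase `φ` on the embedded ray of `x`. -/
noncomputable def rayVector (g : Fin (n + 3) → Fin (n + 3) → ℂ) (φ : ℂ) (x : Fin 3 → ℝ) :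
    Fin (n + 3) → ℂ :=
  (φ / (√(x ⬝ᵥ x) : ℂ)) • frameEmbed g x

lemma star_dotProduct_rayVector_self (hg : ∀ i j, star (g i) ⬝ᵥ g j = if i = j then 1 else 0)
    {φ : ℂ} (hφ : ‖φ‖ = 1) {x : Fin 3 → ℝ} (hx : 0 < x ⬝ᵥ x) :
    star (rayVector g φ x) ⬝ᵥ rayVector g φ x = 1 := by
  have h1 : star φ * φ = 1 := by
    rw [← starRingEnd_apply, Complex.conj_mul', hφ]; simp
  have h2 : ((√(x ⬝ᵥ x) : ℝ) : ℂ) ^ 2 = ((x ⬝ᵥ x : ℝ) : ℂ) := by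
    rw [← Complex.ofReal_pow, Real.sq_sqrt hx.le]
  have h3 : ((√(x ⬝ᵥ x) : ℝ) : ℂ) ≠ 0 := by
    exact_mod_cast (Real.sqrt_pos.2 hx).ne'
  have h4 : star ((√(x ⬝ᵥ x) : ℝ) : ℂ) = ((√(x ⬝ᵥ x) : ℝ) : ℂ) := Complex.conj_ofReal _
  rw [rayVector, star_smul, smul_dotProduct, dotProduct_smul, star_dotProduct_frameEmbed hg,
    star_div₀, h4, ← h2, smul_eq_mul, smul_eq_mul]
  field_simp
  exact h1

lemma star_dotProduct_rayVector_eq_zero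
    (hg : ∀ i j, star (g i) ⬝ᵥ g j = if i = j then 1 else 0) {φ ψ : ℂ}
    {x y : Fin 3 → ℝ} (hxy : x ⬝ᵥ y = 0) : star (rayVector g φ x) ⬝ᵥ rayVector g ψ y = 0 := by
  rw [rayVector, rayVector, star_smul, smul_dotProduct, dotProduct_smul,
    star_dotProduct_frameEmbed hg, hxy]
  simp

lemma star_dotProduct_rayVector_of_three_le
    (hg : ∀ i j, star (g i) ⬝ᵥ g j = if i = j then 1 else 0) (k : Fin n) (φ : ℂ)
    (x : Fin 3 → ℝ) : star (g k.succ.succ.succ) ⬝ᵥ rayVector g φ x = 0 := by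
  rw [rayVector, dotProduct_smul, star_dotProduct_frameEmbed_of_three_le hg, smul_zero]

/-- A unit vector whose squared overlaps with the embedded rays and with the remaining frame
vectors stay out of `[1/d, 1/2]`. -/
lemma exists_direction (hg : ∀ i j, star (g i) ⬝ᵥ g j = if i = j then 1 else 0) :
    ∃ e, star e ⬝ᵥ e = 1 ∧
      (∀ φ : ℂ, ‖φ‖ = 1 → ∀ x, AvoidsBand x →
        ‖star e ⬝ᵥ rayVector g φ x‖ ^ 2 < 1 / (n + 3 : ℕ) ∨
          1 / 2 < ‖star e ⬝ᵥ rayVector g φ x‖ ^ 2) ∧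
      ∀ k : Fin n, ‖star e ⬝ᵥ g k.succ.succ.succ‖ ^ 2 < 1 / (n + 3 : ℕ) ∨
          1 / 2 < ‖star e ⬝ᵥ g k.succ.succ.succ‖ ^ 2 := by
  rcases n with _ | n
  · refine ⟨frameEmbed g ![0, 5 / 13, 12 / 13], ?_, fun φ hφ x hx => ?_, fun k => k.elim0⟩
    · rw [star_dotProduct_frameEmbed hg]
      simp only [dotProduct, Fin.sum_univ_three, Matrix.cons_val]
      norm_num
    · have hpos := hx.dotProduct_self_pos
      have key : ‖star (frameEmbed g ![0, 5 / 13, 12 / 13]) ⬝ᵥ rayVector g φ x‖ ^ 2 =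
          (5 * x 1 + 12 * x 2) ^ 2 / (169 * (x ⬝ᵥ x)) := by
        rw [rayVector, dotProduct_smul, star_dotProduct_frameEmbed hg, norm_smul, norm_div, hφ,
          Complex.norm_real, Complex.norm_real, mul_pow, div_pow, Real.norm_eq_abs,
          Real.norm_eq_abs, sq_abs, sq_abs, Real.sq_sqrt hpos.le]
        simp only [dotProduct, Fin.sum_univ_three, Matrix.cons_val] at hpos ⊢
        field_simp
        ring
      rw [key, div_lt_div_iff₀ (by positivity) (by positivity),
        div_lt_div_iff₀ (by positivity) (by positivity)]
      push_cast
      rcases hx with h | h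
      · left; linarith
      · right; linarith
  · refine ⟨g (Fin.succ (Fin.succ (Fin.succ 0))), by rw [hg]; simp, fun φ _ x _ => ?_, fun k => ?_⟩
    · left
      rw [star_dotProduct_rayVector_of_three_le hg]
      rw [norm_zero, zero_pow two_ne_zero]
      positivity
    · rw [hg]
      split_ifs
      · right; norm_num
      · left
        rw [norm_zero, zero_pow two_ne_zero]
        positivity

lemma IsKSAssignment.isRealKS {T : Finset (Fin (n + 3) → ℂ)} {f : (Fin (n + 3) → ℂ) → ℕ}
    (hf : IsKSAssignment (n + 3) T f)
    (hg : ∀ i j, star (g i) ⬝ᵥ g j = if i = j then 1 else 0) (φ : (Fin 3 → ℝ) → ℂ)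
    {S : Finset (Fin 3 → ℝ)} (hS : ∀ x ∈ S, rayVector g (φ x) x ∈ T)
    (hgT : ∀ k : Fin n, g k.succ.succ.succ ∈ T) (hg0 : ∀ k : Fin n, f (g k.succ.succ.succ) ≠ 1) :
    IsRealKS S fun x => f (rayVector g (φ x) x) := by
  refine ⟨fun u hu w hw huw => hf.2.1 _ (hS u hu) _ (hS w hw)
    (star_dotProduct_rayVector_eq_zero hg huw), fun r hr p hp s hs hrp hrs hps => ?_⟩
  let B : Fin (n + 3) → Fin (n + 3) → ℂ :=
    Fin.cons (rayVector g (φ r) r) (Fin.cons (rayVector g (φ p) p)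
      (Fin.cons (rayVector g (φ s) s) fun k : Fin n => g k.succ.succ.succ))
  have hlt : ∀ k l, k < l → star (B k) ⬝ᵥ B l = 0 := by
    have hG := fun k x => star_dotProduct_eq_zero_comm.1
      (star_dotProduct_rayVector_of_three_le hg k (φ x) x)
    have hR := fun {x y : Fin 3 → ℝ} (h : x ⬝ᵥ y = 0) =>
      star_dotProduct_rayVector_eq_zero hg (φ := φ x) (ψ := φ y) h
    simp only [Fin.forall_fin_succ (n := n + 2), Fin.forall_fin_succ (n := n + 1),
      Fin.forall_fin_succ (n := n), B, Fin.cons_zero, Fin.cons_succ]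
    simp only [lt_irrefl, Fin.succ_lt_succ_iff, Fin.not_lt_zero, Fin.succ_pos, false_imp_iff,
      true_and, implies_true, hG, hR hrp, hR hrs, hR hps, hg, Fin.succ_inj]
    exact fun i j hij => if_neg hij.ne
  obtain ⟨k, hk⟩ := hf.2.2 B (by
      simp [Fin.forall_fin_succ (n := n + 2), Fin.forall_fin_succ (n := n + 1),
        Fin.forall_fin_succ (n := n), B, hS, hr, hp, hs, hgT])
    fun k l hkl => hkl.lt_or_gt.elim (hlt k l) fun h => star_dotProduct_eq_zero_comm.1 (hlt l k h)
  revert k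
  simp only [Fin.forall_fin_succ (n := n + 2), Fin.forall_fin_succ (n := n + 1),
    Fin.forall_fin_succ (n := n), B, Fin.cons_zero, Fin.cons_succ]
  exact ⟨.inl, fun h => .inr (.inl h), fun h => .inr (.inr h), fun k h => absurd h (hg0 k)⟩

lemma exists_trueImpliesFalse_of_realExcludes
    (hg : ∀ i j, star (g i) ⬝ᵥ g j = if i = j then 1 else 0) {u v : Fin 3 → ℝ}
    (huv : RealExcludes u v) (hne : u ≠ v) (hu : u ⬝ᵥ u = 1) (hv : v ⬝ᵥ v = 1) {ω : ℂ}
    (hω : ‖ω‖ = 1) :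
    ∃ S : Finset (Fin (n + 3) → ℂ), frameEmbed g u ∈ S ∧ ω • frameEmbed g v ∈ S ∧
      (∀ x ∈ S, star x ⬝ᵥ x = 1) ∧ (∃ f, IsKSAssignment (n + 3) S f) ∧
      ∀ f, IsKSAssignment (n + 3) S f → f (frameEmbed g u) + f (ω • frameEmbed g v) ≤ 1 := by
  classical
  obtain ⟨S, hS, huS, hvS, hex⟩ := huv
  let φ : (Fin 3 → ℝ) → ℂ := fun x => if x = v then ω else 1
  have hφ : ∀ x, ‖φ x‖ = 1 := fun x => by
    simp only [φ]; split_ifs <;> simp [hω]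
  have hφu : rayVector g (φ u) u = frameEmbed g u := by simp [rayVector, φ, hne, hu]
  have hφv : rayVector g (φ v) v = ω • frameEmbed g v := by simp [rayVector, φ, hv]
  let T := S.image (fun x => rayVector g (φ x) x) ∪
    Finset.univ.image fun k : Fin n => g k.succ.succ.succ
  have hST : ∀ x ∈ S, rayVector g (φ x) x ∈ T := fun x hx =>
    Finset.mem_union_left _ (Finset.mem_image_of_mem _ hx)
  have hgT : ∀ k : Fin n, g k.succ.succ.succ ∈ T := fun k =>
    Finset.mem_union_right _ (Finset.mem_image_of_mem _ (Finset.mem_univ k))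
  have hT : ∀ P : (Fin (n + 3) → ℂ) → Prop, (∀ x ∈ S, P (rayVector g (φ x) x)) →
      (∀ k : Fin n, P (g k.succ.succ.succ)) → ∀ y ∈ T, P y := by
    intro P h1 h2 y hy
    rcases Finset.mem_union.1 hy with hy | hy
    · obtain ⟨x, hx, rfl⟩ := Finset.mem_image.1 hy
      exact h1 x hx
    · obtain ⟨k, -, rfl⟩ := Finset.mem_image.1 hy
      exact h2 k
  have hunit : ∀ y ∈ T, star y ⬝ᵥ y = 1 :=
    hT _ (fun x hx => star_dotProduct_rayVector_self hg (hφ x) (hS x hx).dotProduct_self_pos)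
      fun k => by rw [hg, if_pos rfl]
  rw [← hφu, ← hφv]
  refine ⟨T, hST u huS, hST v hvS, hunit, ?_, fun f hf => ?_⟩
  · obtain ⟨e, he, he1, he2⟩ := exists_direction hg
    exact exists_isKSAssignment he hunit (hT _ (fun x hx => he1 _ (hφ x) x (hS x hx)) he2)
  · by_contra! hgt
    have hu1 : f (rayVector g (φ u) u) = 1 := by
      have := hf.1 _ (hST u huS); have := hf.1 _ (hST v hvS); lia
    have hv1 : f (rayVector g (φ v) v) = 1 := by
      have := hf.1 _ (hST u huS); have := hf.1 _ (hST v hvS); lia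
    refine hex _ (hf.isRealKS hg φ hST hgT fun k hk => ?_) ⟨hu1, hv1⟩
    exact hf.2.1 _ (hgT k) _ (hST u huS) (star_dotProduct_rayVector_of_three_le hg k _ u) ⟨hk, hu1⟩

end Frame

lemma exists_orthogonal_companion {d : ℕ} {a b : Fin d → ℂ} (ha : star a ⬝ᵥ a = 1)
    (hb : star b ⬝ᵥ b = 1) (hli : LinearIndependent ℂ ![a, b]) (hab : star a ⬝ᵥ b ≠ 0) :
    ∃ C : ℝ, 0 < C ∧ C < 1 ∧ ∃ ω : ℂ, ‖ω‖ = 1 ∧ ∃ c : Fin d → ℂ, star c ⬝ᵥ c = 1 ∧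
      star a ⬝ᵥ c = 0 ∧ b = ω • ((C : ℂ) • a + (√(1 - C ^ 2) : ℂ) • c) := by
  set κ := star a ⬝ᵥ b with hκ
  set C := ‖κ‖ with hC
  have hC0 : 0 < C := norm_pos_iff.2 hab
  set ω : ℂ := κ / C with hω
  have hC0' : (C : ℂ) ≠ 0 := by exact_mod_cast hC0.ne'
  have hω1 : ‖ω‖ = 1 := by
    rw [hω, norm_div, Complex.norm_real, norm_norm, div_self hC0.ne']
  have hωs : star ω * ω = 1 := by
    rw [← starRingEnd_apply, Complex.conj_mul', hω1]; simp
  have hωκ : star ω * κ = C := by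
    have : κ = ω * C := by rw [hω]; field_simp
    rw [this, ← mul_assoc, hωs, one_mul]
  set z : Fin d → ℂ := star ω • b - (C : ℂ) • a with hz
  have haz : star a ⬝ᵥ z = 0 := by
    rw [hz, dotProduct_sub, dotProduct_smul, dotProduct_smul, ha, ← hκ, smul_eq_mul, hωκ]
    simp
  have hzz : star z ⬝ᵥ z = ((1 - C ^ 2 : ℝ) : ℂ) := by
    have h1 : star z ⬝ᵥ z = star z ⬝ᵥ (star ω • b) := by
      conv_lhs => rw [hz, dotProduct_sub, dotProduct_smul _ _ a,
        star_dotProduct_eq_zero_comm.1 haz, smul_zero, sub_zero]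
    have hCs : star (C : ℂ) = C := Complex.conj_ofReal C
    rw [h1, hz, star_sub, star_smul, star_smul, sub_dotProduct, smul_dotProduct, smul_dotProduct,
      dotProduct_smul, dotProduct_smul, hb, ← hκ, star_star, hCs]
    simp only [smul_eq_mul]
    push_cast
    linear_combination hωs - (C : ℂ) * hωκ
  have hz0 : z ≠ 0 := by
    intro h
    rw [LinearIndependent.pair_iff] at hli
    have := (hli (-(C : ℂ)) (star ω) (by rw [← h, hz, neg_smul]; abel)).1
    exact hC0' (neg_eq_zero.1 this)
  have hpos : 0 < 1 - C ^ 2 := by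
    rw [← Complex.ofReal_injective ((star_dotProduct_self_eq_norm_sq z).symm.trans hzz)]
    exact pow_pos (norm_pos_iff.2 (by simpa using hz0)) 2
  have hs : (√(1 - C ^ 2) : ℂ) ≠ 0 := by exact_mod_cast (Real.sqrt_pos.2 hpos).ne'
  have hs2 : ((√(1 - C ^ 2) : ℝ) : ℂ) ^ 2 = ((1 - C ^ 2 : ℝ) : ℂ) := by
    rw [← Complex.ofReal_pow, Real.sq_sqrt hpos.le]
  refine ⟨C, hC0, by nlinarith, ω, hω1, (√(1 - C ^ 2) : ℂ)⁻¹ • z, ?_, ?_, ?_⟩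
  · have hss : star ((√(1 - C ^ 2) : ℝ) : ℂ) = ((√(1 - C ^ 2) : ℝ) : ℂ) := Complex.conj_ofReal _
    rw [star_smul, star_inv₀, hss, smul_dotProduct, dotProduct_smul, hzz, ← hs2, smul_eq_mul,
      smul_eq_mul]
    field_simp
  · rw [dotProduct_smul, haz, smul_zero]
  · rw [smul_smul, mul_inv_cancel₀ hs, one_smul, hz, add_sub_cancel, smul_smul, mul_comm, hωs,
      one_smul]

/-- For every `d ≥ 3` and every pair of linearly independent, nonorthogonal
unit vectors `a, b ∈ ℂ^d`, there is a finite set `S` of unit vectors containing `a` and `b`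
which admits at least one KS assignment and such that every KS assignment `f` of `S`
satisfies `f a + f b ≤ 1`; i.e. there is a true-implies-false set between any two
nonorthogonal rays. -/
theorem statement13 (d : ℕ) (hd : 3 ≤ d)
    (a b : Fin d → ℂ)
    (ha : star a ⬝ᵥ a = (1 : ℂ)) (hb : star b ⬝ᵥ b = (1 : ℂ))
    (hli : LinearIndependent ℂ ![a, b])
    (hnonorth : star a ⬝ᵥ b ≠ 0) :
    ∃ S : Finset (Fin d → ℂ),
      a ∈ S ∧ b ∈ S ∧
      (∀ x ∈ S, star x ⬝ᵥ x = (1 : ℂ)) ∧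
      (∃ f : (Fin d → ℂ) → ℕ, IsKSAssignment d S f) ∧
      (∀ f : (Fin d → ℂ) → ℕ, IsKSAssignment d S f → f a + f b ≤ 1) := by
  obtain ⟨n, rfl⟩ := Nat.exists_eq_add_of_le' hd
  obtain ⟨C, hC0, hC1, ω, hω, c, hc, hac, hbeq⟩ := exists_orthogonal_companion ha hb hli hnonorth
  obtain ⟨a₀, a₁, b₀, b₁, ha1, hb1, hdot, hcross, hex⟩ := exists_realExcludes hC0 hC1
  have hca := star_dotProduct_eq_zero_comm.1 hac
  have hr (r : ℝ) : star (r : ℂ) = r := Complex.conj_ofReal r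
  have ha1' : (a₀ : ℂ) ^ 2 + (a₁ : ℂ) ^ 2 = 1 := by exact_mod_cast ha1
  obtain ⟨g, hg, hg0, hg1⟩ := exists_frame
    (x := (a₀ : ℂ) • a - (a₁ : ℂ) • c) (y := (a₁ : ℂ) • a + (a₀ : ℂ) • c)
    (by simp only [star_sub, star_smul, sub_dotProduct, dotProduct_sub, smul_dotProduct,
          dotProduct_smul, ha, hc, hac, hca, hr, smul_eq_mul]
        linear_combination ha1')
    (by simp only [star_add, star_smul, add_dotProduct, dotProduct_add, smul_dotProduct,
          dotProduct_smul, ha, hc, hac, hca, hr, smul_eq_mul]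
        linear_combination ha1')
    (by simp only [star_sub, star_smul, sub_dotProduct, dotProduct_add, smul_dotProduct,
          dotProduct_smul, ha, hc, hac, hca, hr, smul_eq_mul]
        ring)
  have hau : frameEmbed g ![a₀, a₁, 0] = a := by
    ext i
    simp only [frameEmbed, hg0, hg1, Matrix.cons_val, Pi.add_apply, Pi.sub_apply, Pi.smul_apply,
      smul_eq_mul, Complex.ofReal_zero]
    linear_combination a i * ha1'
  have hbv : ω • frameEmbed g ![b₀, b₁, 0] = b := by
    rw [hbeq, ← hcross, ← hdot]
    congr 1
    ext i
    simp only [frameEmbed, hg0, hg1, Matrix.cons_val, Pi.add_apply, Pi.sub_apply, Pi.smul_apply,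
      smul_eq_mul, Complex.ofReal_zero]
    push_cast
    ring
  have hne : ![a₀, a₁, 0] ≠ ![b₀, b₁, 0] := by
    intro h
    have h0 : a₀ = b₀ := by simpa using congrFun h 0
    have h1 : a₁ = b₁ := by simpa using congrFun h 1
    subst h0 h1
    nlinarith
  have := exists_trueImpliesFalse_of_realExcludes hg hex hne
    (by simp [dotProduct, Fin.sum_univ_three]; linarith)
    (by simp [dotProduct, Fin.sum_univ_three]; linarith) hω
  rwa [hau, hbv] at this
end

section
/- For every dimension d ≥ 3, there exists a finite set S of exactly d + 5 unit vectors in ℂ^d, containing two distinguished linearly independent, nonorthogonal vectors a and b, such that S admits at least one KS assignment and every KS assignment f of S satisfies f(a) + f(b) ≤ 1; that is, in every dimension d ≥ 3 there is a true-implies-false set with d + 5 rank-one projectors. -/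
open BigOperators Finset Matrix

/-- Unnormalised rays of the eight-vertex Clifton graph in dimension three. The vertices `0` and `1`
are the distinguished ones, `{2, 3, 6}` and `{4, 5, 7}` are orthogonal bases, and `6 ⟂ 7`. -/
def cliftonRay : Fin 8 → Fin 3 → ℤ :=
  ![![1, -1, -1], ![1, 1, 1], ![1, 1, 0], ![1, -1, 0], ![1, 0, 1], ![1, 0, -1],
    ![0, 0, 1], ![0, 1, 0]]

/-- The inverse Euclidean norm of a Clifton ray. -/
noncomputable def cliftonScale (i : Fin 8) : ℝ :=
  (√((cliftonRay i ⬝ᵥ cliftonRay i : ℤ) : ℝ))⁻¹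

/-- The normalised Clifton vectors, padded by zeros, together with the remaining `n` standard basis
vectors of `ℂ^(3 + n)`. -/
noncomputable def cliftonVec (n : ℕ) : Fin 8 ⊕ Fin n → Fin (3 + n) → ℂ
  | .inl i => Fin.append (fun j => (cliftonScale i : ℂ) * (cliftonRay i j : ℂ)) 0
  | .inr k => Fin.append 0 (Pi.single k 1)

/-- The orthogonality relation of the vectors `cliftonVec n`. -/
def CliftonOrth {n : ℕ} : Fin 8 ⊕ Fin n → Fin 8 ⊕ Fin n → Prop
  | .inl i, .inl j => cliftonRay i ⬝ᵥ cliftonRay j = 0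
  | .inr k, .inr l => k ≠ l
  | _, _ => True

lemma star_append_dotProduct_append {m n : ℕ} (u u' : Fin m → ℂ) (w w' : Fin n → ℂ) :
    star (Fin.append u w) ⬝ᵥ Fin.append u' w' = star u ⬝ᵥ u' + star w ⬝ᵥ w' := by
  simp [dotProduct, Fin.sum_univ_add]

lemma star_dotProduct_scaled_ray (i j : Fin 8) :
    star (fun s => (cliftonScale i : ℂ) * (cliftonRay i s : ℂ)) ⬝ᵥ
        (fun s => (cliftonScale j : ℂ) * (cliftonRay j s : ℂ)) =
      ((cliftonScale i * cliftonScale j : ℝ) : ℂ) * ((cliftonRay i ⬝ᵥ cliftonRay j : ℤ) : ℂ) := by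
  simp only [dotProduct, Pi.star_apply, star_mul', Complex.star_def, Complex.conj_ofReal,
    map_intCast, Fin.sum_univ_three]
  push_cast
  ring

lemma cliftonRay_dotProduct_self_pos (i : Fin 8) : 0 < cliftonRay i ⬝ᵥ cliftonRay i := by
  revert i; decide

lemma cliftonScale_pos (i : Fin 8) : 0 < cliftonScale i :=
  inv_pos.2 (Real.sqrt_pos.2 (Int.cast_pos.2 (cliftonRay_dotProduct_self_pos i)))

lemma star_cliftonVec_dotProduct_self {n : ℕ} (x : Fin 8 ⊕ Fin n) :
    star (cliftonVec n x) ⬝ᵥ cliftonVec n x = 1 := by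
  rcases x with i | k
  · have h : (0 : ℝ) < ((cliftonRay i ⬝ᵥ cliftonRay i : ℤ) : ℝ) :=
      Int.cast_pos.2 (cliftonRay_dotProduct_self_pos i)
    have h' : cliftonScale i * cliftonScale i * ((cliftonRay i ⬝ᵥ cliftonRay i : ℤ) : ℝ) = 1 := by
      rw [cliftonScale, ← mul_inv, Real.mul_self_sqrt h.le, inv_mul_cancel₀ h.ne']
    rw [cliftonVec, star_append_dotProduct_append, star_dotProduct_scaled_ray, dotProduct_zero,
      add_zero]
    exact_mod_cast h'
  · simp [cliftonVec, star_append_dotProduct_append]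

lemma star_cliftonVec_dotProduct_eq_zero {n : ℕ} (x y : Fin 8 ⊕ Fin n) :
    star (cliftonVec n x) ⬝ᵥ cliftonVec n y = 0 ↔ CliftonOrth x y := by
  rcases x with i | k <;> rcases y with j | l
  · rw [cliftonVec, cliftonVec, star_append_dotProduct_append, star_dotProduct_scaled_ray,
      dotProduct_zero, add_zero, mul_eq_zero, Complex.ofReal_eq_zero, Int.cast_eq_zero,
      or_iff_right (mul_pos (cliftonScale_pos i) (cliftonScale_pos j)).ne', CliftonOrth]
  · simp [cliftonVec, star_append_dotProduct_append, CliftonOrth]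
  · simp [cliftonVec, star_append_dotProduct_append, CliftonOrth]
  · simp [cliftonVec, star_append_dotProduct_append, CliftonOrth, Pi.single_apply, eq_comm]

lemma cliftonVec_injective (n : ℕ) : Function.Injective (cliftonVec n) := by
  intro x y hxy
  have key : ∀ z, CliftonOrth x z ↔ CliftonOrth y z := fun z => by
    rw [← star_cliftonVec_dotProduct_eq_zero, ← star_cliftonVec_dotProduct_eq_zero, hxy]
  rcases x with i | k <;> rcases y with j | l
  · have separated : ∀ i j : Fin 8, (∀ z, cliftonRay i ⬝ᵥ cliftonRay z = 0 ↔
        cliftonRay j ⬝ᵥ cliftonRay z = 0) → i = j := by decide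
    exact congrArg _ (separated i j fun z => key (.inl z))
  · simpa [CliftonOrth] using key (.inr l)
  · simpa [CliftonOrth] using key (.inr k)
  · have := key (.inr k)
    simp only [CliftonOrth, ne_eq, not_true_eq_false, false_iff, not_not] at this
    rw [this]

/-- A partition of the Clifton vertices other than `4` and `6` into two classes without orthogonal
pairs. -/
def cliftonClass : Fin 8 → Fin 2 := ![0, 1, 1, 0, 0, 0, 0, 1]

lemma not_cliftonOrth_of_class_eq {n : ℕ} {x y : Fin 8 ⊕ Fin n}
    (hx : x ≠ .inl 4 ∧ x ≠ .inl 6) (hy : y ≠ .inl 4 ∧ y ≠ .inl 6)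
    (h : Sum.map cliftonClass id x = Sum.map cliftonClass id y) : ¬ CliftonOrth x y := by
  rcases x with i | k <;> rcases y with j | l
  · have nonorth : ∀ i j : Fin 8, i ≠ 4 ∧ i ≠ 6 → j ≠ 4 ∧ j ≠ 6 →
        cliftonClass i = cliftonClass j → ¬ cliftonRay i ⬝ᵥ cliftonRay j = 0 := by decide
    exact nonorth i j (by simpa using hx) (by simpa using hy) (by simpa using h)
  · simp at h
  · simp at h
  · simpa [CliftonOrth] using h

lemma exists_isKSAssignment_cliftonVec (n : ℕ) :
    ∃ f, IsKSAssignment (3 + n) (univ.image (cliftonVec n)) f := by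
  set f : (Fin (3 + n) → ℂ) → ℕ := fun u =>
    if u = cliftonVec n (.inl 4) ∨ u = cliftonVec n (.inl 6) then 1 else 0 with hf
  have f_eq_one : ∀ x, f (cliftonVec n x) = 1 ↔ x = .inl 4 ∨ x = .inl 6 := fun x => by
    simp only [hf, (cliftonVec_injective n).eq_iff]
    split_ifs <;> simp_all
  refine ⟨f, fun u _ => ?_, fun u hu w hw h => ?_, fun b hb horth => ?_⟩
  · by_cases h : u = cliftonVec n (.inl 4) ∨ u = cliftonVec n (.inl 6) <;> simp [hf, h]
  · obtain ⟨x, -, rfl⟩ := mem_image.1 hu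
    obtain ⟨y, -, rfl⟩ := mem_image.1 hw
    rw [star_cliftonVec_dotProduct_eq_zero] at h
    rw [f_eq_one, f_eq_one]
    rintro ⟨rfl | rfl, rfl | rfl⟩ <;> revert h <;> rw [CliftonOrth] <;> decide
  · choose c _ hc using fun k => mem_image.1 (hb k)
    by_contra! hne
    have avoid : ∀ k, c k ≠ .inl 4 ∧ c k ≠ .inl 6 := fun k => by
      rw [← not_or, ← f_eq_one, hc]
      exact hne k
    obtain ⟨k, l, hkl, h⟩ := Fintype.exists_ne_map_eq_of_card_lt
      (fun k => Sum.map cliftonClass (id : Fin n → Fin n) (c k)) (by simp)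
    refine not_cliftonOrth_of_class_eq (avoid k) (avoid l) h ?_
    rw [← star_cliftonVec_dotProduct_eq_zero, hc, hc]
    exact horth k l hkl

/-- An orthogonal basis of Clifton vertices, completed by the remaining standard basis vectors,
contains a vector assigned one. -/
lemma IsKSAssignment.exists_eq_one_of_clifton_basis {n : ℕ} {f : (Fin (3 + n) → ℂ) → ℕ}
    (hf : IsKSAssignment (3 + n) (univ.image (cliftonVec n)) f) (t : Fin 3 → Fin 8)
    (ht : ∀ r s, r ≠ s → cliftonRay (t r) ⬝ᵥ cliftonRay (t s) = 0) :
    (∃ r, f (cliftonVec n (.inl (t r))) = 1) ∨ ∃ k, f (cliftonVec n (.inr k)) = 1 := by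
  obtain ⟨k, hk⟩ := hf.2.2 (fun k => cliftonVec n (Sum.map t id (finSumFinEquiv.symm k)))
    (fun k => mem_image_of_mem _ (mem_univ _)) (fun k l hkl => by
      rw [star_cliftonVec_dotProduct_eq_zero]
      have hkl' := finSumFinEquiv.symm.injective.ne hkl
      generalize finSumFinEquiv.symm k = x at hkl' ⊢
      generalize finSumFinEquiv.symm l = y at hkl' ⊢
      rcases x with r | k <;> rcases y with s | l
      · exact ht r s (by simpa using hkl')
      · trivial
      · trivial
      · simpa [CliftonOrth] using hkl')
  rcases h : finSumFinEquiv.symm k with r | s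
  · exact .inl ⟨r, by simpa [h] using hk⟩
  · exact .inr ⟨s, by simpa [h] using hk⟩

lemma IsKSAssignment.clifton_add_le_one {n : ℕ} {f : (Fin (3 + n) → ℂ) → ℕ}
    (hf : IsKSAssignment (3 + n) (univ.image (cliftonVec n)) f) :
    f (cliftonVec n (.inl 0)) + f (cliftonVec n (.inl 1)) ≤ 1 := by
  have mem : ∀ x, cliftonVec n x ∈ univ.image (cliftonVec n) :=
    fun x => mem_image_of_mem _ (mem_univ _)
  have exclusive : ∀ x y, CliftonOrth x y →
      f (cliftonVec n x) = 1 → f (cliftonVec n y) ≠ 1 := fun x y h hx hy =>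
    hf.2.1 _ (mem x) _ (mem y) ((star_cliftonVec_dotProduct_eq_zero x y).2 h) ⟨hx, hy⟩
  have exclusive_ray : ∀ i j, cliftonRay i ⬝ᵥ cliftonRay j = 0 →
      f (cliftonVec n (.inl i)) = 1 → f (cliftonVec n (.inl j)) ≠ 1 :=
    fun i j h => exclusive (.inl i) (.inl j) h
  by_contra! hlt
  have ha : f (cliftonVec n (.inl 0)) = 1 := by
    have := hf.1 _ (mem (.inl 0)); have := hf.1 _ (mem (.inl 1)); omega
  have hb : f (cliftonVec n (.inl 1)) = 1 := by
    have := hf.1 _ (mem (.inl 0)); have := hf.1 _ (mem (.inl 1)); omega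
  have h6 : f (cliftonVec n (.inl 6)) = 1 := by
    rcases hf.exists_eq_one_of_clifton_basis ![2, 3, 6] (by decide) with ⟨r, hr⟩ | ⟨k, hk⟩
    · fin_cases r
      · exact absurd hr (exclusive_ray 0 2 (by decide) ha)
      · exact absurd hr (exclusive_ray 1 3 (by decide) hb)
      · exact hr
    · exact absurd hk (exclusive (.inl 0) (.inr k) trivial ha)
  have h7 : f (cliftonVec n (.inl 7)) = 1 := by
    rcases hf.exists_eq_one_of_clifton_basis ![4, 5, 7] (by decide) with ⟨r, hr⟩ | ⟨k, hk⟩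
    · fin_cases r
      · exact absurd hr (exclusive_ray 0 4 (by decide) ha)
      · exact absurd hr (exclusive_ray 1 5 (by decide) hb)
      · exact hr
    · exact absurd hk (exclusive (.inl 0) (.inr k) trivial ha)
  exact exclusive_ray 6 7 (by decide) h6 h7

lemma star_cliftonVec_inl_dotProduct_eq_zero {n : ℕ} (i j : Fin 8) :
    star (cliftonVec n (.inl i)) ⬝ᵥ cliftonVec n (.inl j) = 0 ↔
      cliftonRay i ⬝ᵥ cliftonRay j = 0 :=
  star_cliftonVec_dotProduct_eq_zero (.inl i) (.inl j)

lemma linearIndependent_cliftonVec_pair (n : ℕ) :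
    LinearIndependent ℂ ![cliftonVec n (.inl 0), cliftonVec n (.inl 1)] := by
  rw [LinearIndependent.pair_iff]
  intro s t h
  have pairing : ∀ i, s * (star (cliftonVec n (.inl i)) ⬝ᵥ cliftonVec n (.inl 0)) +
      t * (star (cliftonVec n (.inl i)) ⬝ᵥ cliftonVec n (.inl 1)) = 0 := fun i => by
    simpa using congrArg (star (cliftonVec n (.inl i)) ⬝ᵥ ·) h
  constructor
  · have h3 := pairing 3
    rw [(star_cliftonVec_inl_dotProduct_eq_zero 3 1).2 (by decide), mul_zero, add_zero] at h3
    exact (mul_eq_zero.1 h3).resolve_right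
      (mt (star_cliftonVec_inl_dotProduct_eq_zero 3 0).1 (by decide))
  · have h2 := pairing 2
    rw [(star_cliftonVec_inl_dotProduct_eq_zero 2 0).2 (by decide), mul_zero, zero_add] at h2
    exact (mul_eq_zero.1 h2).resolve_right
      (mt (star_cliftonVec_inl_dotProduct_eq_zero 2 1).1 (by decide))

/-- For every dimension `d ≥ 3`, there exists a finite set `S` of exactly
`d + 5` unit vectors in `ℂ^d`, containing two distinguished linearly independent,
nonorthogonal vectors `a` and `b`, such that `S` admits at least one KS assignment and
every KS assignment `f` of `S` satisfies `f a + f b ≤ 1`; i.e. in every dimension `d ≥ 3`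
there is a true-implies-false set with `d + 5` rank-one projectors. -/
theorem statement14 (d : ℕ) (hd : 3 ≤ d) :
    ∃ S : Finset (Fin d → ℂ), S.card = d + 5 ∧
      ∃ a ∈ S, ∃ b ∈ S,
        (∀ x ∈ S, star x ⬝ᵥ x = (1 : ℂ)) ∧
        LinearIndependent ℂ ![a, b] ∧
        star a ⬝ᵥ b ≠ 0 ∧
        (∃ f : (Fin d → ℂ) → ℕ, IsKSAssignment d S f) ∧
        (∀ f : (Fin d → ℂ) → ℕ, IsKSAssignment d S f → f a + f b ≤ 1) := by
  obtain ⟨n, rfl⟩ := Nat.exists_eq_add_of_le hd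
  refine ⟨univ.image (cliftonVec n), ?_, cliftonVec n (.inl 0), mem_image_of_mem _ (mem_univ _),
    cliftonVec n (.inl 1), mem_image_of_mem _ (mem_univ _), fun x hx => ?_,
    linearIndependent_cliftonVec_pair n,
    mt (star_cliftonVec_inl_dotProduct_eq_zero 0 1).1 (by decide),
    exists_isKSAssignment_cliftonVec n, fun f hf => hf.clifton_add_le_one⟩
  · rw [card_image_of_injective _ (cliftonVec_injective n), card_univ, Fintype.card_sum,
      Fintype.card_fin, Fintype.card_fin]
    omega
  · obtain ⟨y, -, rfl⟩ := mem_image.1 hx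
    exact star_cliftonVec_dotProduct_self y
end

section
/- There exists a finite set of unit vectors in ℝ^3 that admits no KS assignment; that is, KS sets exist in dimension 3 (the Kochen–Specker theorem, realized by Kochen and Specker's 117-vector set). -/
open BigOperators Finset Matrix

/-- A KS assignment for a finite set `S` of vectors in `ℝ^3`: a 0/1 assignment such that
(I) no two orthogonal vectors of `S` are both assigned 1, and (II) among any 3 mutually
orthogonal vectors of `S` at least one is assigned 1. -/
def IsKSAssignmentR3 (S : Finset (Fin 3 → ℝ)) (f : (Fin 3 → ℝ) → ℕ) : Prop :=
  (∀ u ∈ S, f u = 0 ∨ f u = 1) ∧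
  (∀ u ∈ S, ∀ w ∈ S, u ⬝ᵥ w = 0 → ¬(f u = 1 ∧ f w = 1)) ∧
  (∀ b : Fin 3 → (Fin 3 → ℝ), (∀ k, b k ∈ S) →
    (∀ k l, k ≠ l → b k ⬝ᵥ b l = 0) → ∃ k, f (b k) = 1)

/-- The nonzero integer vectors of `ℤ^3` with all coordinates in `{-2, …, 2}`. -/
noncomputable def smallVectors : Finset (Fin 3 → ℤ) :=
  {u ∈ Fintype.piFinset fun _ => Finset.Icc (-2) 2 | u ≠ 0}

theorem mem_smallVectors {u : Fin 3 → ℤ} :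
    u ∈ smallVectors ↔ (∀ i, -2 ≤ u i ∧ u i ≤ 2) ∧ u ≠ 0 := by
  simp [smallVectors]

/-- A set of directions, given by a predicate on small integer vectors, that contains no two
orthogonal vectors and meets every orthogonal triad. -/
structure IsIntegralKSAssignment (c : (Fin 3 → ℤ) → Prop) : Prop where
  exclusive : ∀ u ∈ smallVectors, ∀ w ∈ smallVectors, u ⬝ᵥ w = 0 → c u → ¬c w
  covering : ∀ u ∈ smallVectors, ∀ v ∈ smallVectors, ∀ w ∈ smallVectors,
    u ⬝ᵥ v = 0 → u ⬝ᵥ w = 0 → v ⬝ᵥ w = 0 → ¬c u → ¬c v → c w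

namespace IsIntegralKSAssignment

variable {c : (Fin 3 → ℤ) → Prop}

theorem comp (hc : IsIntegralKSAssignment c) (T : (Fin 3 → ℤ) → (Fin 3 → ℤ))
    (hT : ∀ u ∈ smallVectors, T u ∈ smallVectors)
    (hdot : ∀ u w, T u ⬝ᵥ T w = u ⬝ᵥ w) : IsIntegralKSAssignment fun u => c (T u) where
  exclusive u hu w hw h := hc.exclusive _ (hT u hu) _ (hT w hw) (by rw [hdot, h])
  covering u hu v hv w hw huv huw hvw := hc.covering _ (hT u hu) _ (hT v hv) _ (hT w hw)
    (by rw [hdot, huv]) (by rw [hdot, huw]) (by rw [hdot, hvw])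

theorem comp_perm (hc : IsIntegralKSAssignment c) (σ : Equiv.Perm (Fin 3)) :
    IsIntegralKSAssignment fun u => c (u ∘ σ) := by
  refine hc.comp (fun u => u ∘ σ) (fun u hu => ?_) fun u w => comp_equiv_dotProduct_comp_equiv u w σ
  rw [mem_smallVectors] at hu ⊢
  refine ⟨fun i => hu.1 (σ i), fun h => hu.2 (funext fun i => ?_)⟩
  simpa using congrFun h (σ.symm i)

theorem comp_neg_second (hc : IsIntegralKSAssignment c) :
    IsIntegralKSAssignment fun u => c ![u 0, -u 1, u 2] := by
  refine hc.comp (fun u => ![u 0, -u 1, u 2]) (fun u hu => ?_) fun u w => ?_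
  · rw [mem_smallVectors] at hu ⊢
    obtain ⟨hb, hne⟩ := hu
    refine ⟨fun i => ?_, fun h => hne (funext fun i => ?_)⟩
    · have := hb i
      fin_cases i <;> simp at this ⊢ <;> omega
    · have := congrFun h i
      fin_cases i <;> simpa using this
  · simp [dotProduct, Fin.sum_univ_three]

/-- A vector that is orthogonal to one in the set is outside it. -/
theorem not_of_orthogonal (hc : IsIntegralKSAssignment c) {u : Fin 3 → ℤ} (hu : c u)
    (w : Fin 3 → ℤ) (h : u ∈ smallVectors ∧ w ∈ smallVectors ∧ u ⬝ᵥ w = 0) : ¬c w :=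
  hc.exclusive u h.1 w h.2.1 h.2.2 hu

/-- A vector that completes two vectors outside the set to an orthogonal triad is in the set. -/
theorem of_orthogonal (hc : IsIntegralKSAssignment c) {u v : Fin 3 → ℤ} (hu : ¬c u) (hv : ¬c v)
    (w : Fin 3 → ℤ) (h : (u ∈ smallVectors ∧ v ∈ smallVectors ∧ w ∈ smallVectors) ∧
      u ⬝ᵥ v = 0 ∧ u ⬝ᵥ w = 0 ∧ v ⬝ᵥ w = 0) : c w :=
  hc.covering u h.1.1 v h.1.2.1 w h.1.2.2 h.2.1 h.2.2.1 h.2.2.2 hu hv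

/-- The vectors `(1, 0, 0)` and `(1, 1, 0)` cannot both be in the set: otherwise all three of
`(0, 1, 0)`, `(1, 0, -1)` and `(1, 0, 1)` would be excluded. -/
theorem not_diagonal (hc : IsIntegralKSAssignment c) (h100 : c ![1, 0, 0]) :
    ¬c ![1, 1, 0] := by
  intro h110
  have h01n1 := hc.not_of_orthogonal h100 ![0, 1, -1]
    (by simp_rw [mem_smallVectors]; decide)
  have h010 := hc.not_of_orthogonal h100 ![0, 1, 0]
    (by simp_rw [mem_smallVectors]; decide)
  have h011 := hc.not_of_orthogonal h100 ![0, 1, 1]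
    (by simp_rw [mem_smallVectors]; decide)
  have h1n1n1 := hc.not_of_orthogonal h110 ![1, -1, -1]
    (by simp_rw [mem_smallVectors]; decide)
  have h1n10 := hc.not_of_orthogonal h110 ![1, -1, 0]
    (by simp_rw [mem_smallVectors]; decide)
  have h1n11 := hc.not_of_orthogonal h110 ![1, -1, 1]
    (by simp_rw [mem_smallVectors]; decide)
  have h211 := hc.of_orthogonal h01n1 h1n1n1 ![2, 1, 1]
    (by simp_rw [mem_smallVectors]; decide)
  have h21n1 := hc.of_orthogonal h011 h1n11 ![2, 1, -1]
    (by simp_rw [mem_smallVectors]; decide)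
  have h10n2 := hc.not_of_orthogonal h211 ![1, 0, -2]
    (by simp_rw [mem_smallVectors]; decide)
  have h102 := hc.not_of_orthogonal h21n1 ![1, 0, 2]
    (by simp_rw [mem_smallVectors]; decide)
  have h201 := hc.of_orthogonal h010 h10n2 ![2, 0, 1]
    (by simp_rw [mem_smallVectors]; decide)
  have h20n1 := hc.of_orthogonal h010 h102 ![2, 0, -1]
    (by simp_rw [mem_smallVectors]; decide)
  have h11n2 := hc.not_of_orthogonal h201 ![1, 1, -2]
    (by simp_rw [mem_smallVectors]; decide)
  have h112 := hc.not_of_orthogonal h20n1 ![1, 1, 2]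
    (by simp_rw [mem_smallVectors]; decide)
  have h111 := hc.of_orthogonal h1n10 h11n2 ![1, 1, 1]
    (by simp_rw [mem_smallVectors]; decide)
  have h11n1 := hc.of_orthogonal h1n10 h112 ![1, 1, -1]
    (by simp_rw [mem_smallVectors]; decide)
  have h10n1 := hc.not_of_orthogonal h111 ![1, 0, -1]
    (by simp_rw [mem_smallVectors]; decide)
  have h101 := hc.not_of_orthogonal h11n1 ![1, 0, 1]
    (by simp_rw [mem_smallVectors]; decide)
  exact h101 (hc.of_orthogonal h010 h10n1 ![1, 0, 1]
    (by simp_rw [mem_smallVectors]; decide))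

theorem not_first_axis (hc : IsIntegralKSAssignment c) : ¬c ![1, 0, 0] := by
  intro h100
  have h001 := hc.not_of_orthogonal h100 ![0, 0, 1]
    (by simp_rw [mem_smallVectors]; decide)
  have h110 := hc.not_diagonal h100
  have h1n10 := hc.of_orthogonal h001 h110 ![1, -1, 0]
    (by simp_rw [mem_smallVectors]; decide)
  exact hc.comp_neg_second.not_diagonal (by simpa using h100) (by simpa using h1n10)

end IsIntegralKSAssignment

theorem not_isIntegralKSAssignment (c : (Fin 3 → ℤ) → Prop) : ¬IsIntegralKSAssignment c := by
  intro hc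
  have h010 : ¬c ![0, 1, 0] := by
    convert (hc.comp_perm (Equiv.swap 0 1)).not_first_axis using 2
    decide
  have h001 : ¬c ![0, 0, 1] := by
    convert (hc.comp_perm (Equiv.swap 0 2)).not_first_axis using 2
    decide
  exact hc.not_first_axis (hc.of_orthogonal h010 h001 ![1, 0, 0]
    (by simp_rw [mem_smallVectors]; decide))

/-- The real unit vector in the direction of an integer vector. -/
noncomputable def unitDirection (u : Fin 3 → ℤ) : Fin 3 → ℝ :=
  (√((u ⬝ᵥ u : ℤ) : ℝ))⁻¹ • fun i => (u i : ℝ)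

theorem unitDirection_dotProduct (u w : Fin 3 → ℤ) :
    unitDirection u ⬝ᵥ unitDirection w =
      (√((u ⬝ᵥ u : ℤ) : ℝ))⁻¹ * (√((w ⬝ᵥ w : ℤ) : ℝ))⁻¹ * ((u ⬝ᵥ w : ℤ) : ℝ) := by
  simp only [unitDirection, dotProduct, Pi.smul_apply, smul_eq_mul, Int.cast_sum, Int.cast_mul,
    Finset.mul_sum]
  exact Finset.sum_congr rfl fun i _ => by ring

theorem unitDirection_dotProduct_self {u : Fin 3 → ℤ} (hu : u ≠ 0) :
    unitDirection u ⬝ᵥ unitDirection u = 1 := by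
  have hpos : (0 : ℝ) < ((u ⬝ᵥ u : ℤ) : ℝ) := by
    have h0 : 0 ≤ u ⬝ᵥ u := Finset.sum_nonneg fun i _ => mul_self_nonneg (u i)
    exact_mod_cast h0.lt_of_ne fun h => hu (dotProduct_self_eq_zero.1 h.symm)
  rw [unitDirection_dotProduct, ← mul_inv, Real.mul_self_sqrt hpos.le, inv_mul_cancel₀ hpos.ne']

theorem unitDirection_dotProduct_eq_zero {u w : Fin 3 → ℤ} (h : u ⬝ᵥ w = 0) :
    unitDirection u ⬝ᵥ unitDirection w = 0 := by
  rw [unitDirection_dotProduct, h, Int.cast_zero, mul_zero]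

theorem IsKSAssignmentR3.isIntegralKSAssignment {f : (Fin 3 → ℝ) → ℕ}
    (hf : IsKSAssignmentR3 (smallVectors.image unitDirection) f) :
    IsIntegralKSAssignment fun u => f (unitDirection u) = 1 := by
  obtain ⟨-, hexcl, hcov⟩ := hf
  refine ⟨fun u hu w hw h h1 h2 => hexcl _ (mem_image_of_mem _ hu) _ (mem_image_of_mem _ hw)
    (unitDirection_dotProduct_eq_zero h) ⟨h1, h2⟩, fun u hu v hv w hw huv huw hvw hcu hcv => ?_⟩
  have horth : ∀ k l, k ≠ l → ![u, v, w] k ⬝ᵥ ![u, v, w] l = 0 := by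
    intro k l hkl
    fin_cases k <;> fin_cases l <;> simp_all [dotProduct_comm]
  obtain ⟨k, hk⟩ := hcov (fun k => unitDirection (![u, v, w] k))
    (fun k => mem_image_of_mem _ (by fin_cases k <;> simpa))
    fun k l hkl => unitDirection_dotProduct_eq_zero (horth k l hkl)
  fin_cases k
  · exact absurd hk hcu
  · exact absurd hk hcv
  · exact hk

/-- The Kochen–Specker theorem in dimension 3: there exists a finite set of
unit vectors in `ℝ^3` that admits no KS assignment, i.e. KS sets exist in dimension 3. -/
theorem statement16 :
    ∃ S : Finset (Fin 3 → ℝ),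
      (∀ x ∈ S, x ⬝ᵥ x = (1 : ℝ)) ∧
      ¬ ∃ f : (Fin 3 → ℝ) → ℕ, IsKSAssignmentR3 S f := by
  refine ⟨smallVectors.image unitDirection, fun x hx => ?_, fun ⟨_, hf⟩ =>
    not_isIntegralKSAssignment _ hf.isIntegralKSAssignment⟩
  obtain ⟨u, hu, rfl⟩ := mem_image.1 hx
  exact unitDirection_dotProduct_self (mem_smallVectors.1 hu).2
end

section
/- There are no KS sets in dimension 2: every finite set S of unit vectors in ℂ^2 admits a KS assignment, i.e., a function f : S → {0,1} such that no two orthogonal vectors of S are both assigned 1 and among any two mutually orthogonal vectors of S at least one is assigned 1. -/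
open BigOperators Finset Matrix

/-- A KS assignment for a finite set `S` of vectors in `ℂ^2`: a 0/1 assignment such that
(I) no two orthogonal vectors of `S` are both assigned 1, and (II) among any 2 mutually
orthogonal vectors of `S` at least one is assigned 1. -/
def IsKSAssignment2 (S : Finset (Fin 2 → ℂ)) (f : (Fin 2 → ℂ) → ℕ) : Prop :=
  (∀ u ∈ S, f u = 0 ∨ f u = 1) ∧
  (∀ u ∈ S, ∀ w ∈ S, star u ⬝ᵥ w = 0 → ¬(f u = 1 ∧ f w = 1)) ∧
  (∀ b : Fin 2 → (Fin 2 → ℂ), (∀ k, b k ∈ S) →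
    (∀ k l, k ≠ l → star (b k) ⬝ᵥ b l = 0) → ∃ k, f (b k) = 1)

/-- The Bloch vector of `x : ℂ^2` lies in the lexicographically positive half-space. -/
def BlochPos (x : Fin 2 → ℂ) : Prop :=
  Complex.normSq (x 1) < Complex.normSq (x 0) ∨
    Complex.normSq (x 0) = Complex.normSq (x 1) ∧
      (0 < (star (x 0) * x 1).re ∨ (star (x 0) * x 1).re = 0 ∧ 0 < (star (x 0) * x 1).im)

/-- Orthogonal unit vectors of `ℂ^2` have opposite Bloch vectors. -/
lemma bloch_antipodal {u v : Fin 2 → ℂ} (hu : star u ⬝ᵥ u = 1) (hv : star v ⬝ᵥ v = 1)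
    (huv : star u ⬝ᵥ v = 0) :
    Complex.normSq (v 0) = Complex.normSq (u 1) ∧ Complex.normSq (v 1) = Complex.normSq (u 0) ∧
      star (v 0) * v 1 = -(star (u 0) * u 1) := by
  simp only [dotProduct, Fin.sum_univ_two, Pi.star_apply] at hu hv huv
  have huv' : u 0 * star (v 0) + u 1 * star (v 1) = 0 := by
    simpa using congrArg star huv
  refine ⟨?_, ?_, ?_⟩
  · rw [← Complex.ofReal_inj, Complex.normSq_eq_conj_mul_self, Complex.normSq_eq_conj_mul_self]
    change star (v 0) * v 0 = star (u 1) * u 1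
    linear_combination (-(v 0 * star (v 0))) * hu + u 1 * star (u 1) * hv +
      u 0 * star (v 0) * huv - star (u 1) * v 1 * huv'
  · rw [← Complex.ofReal_inj, Complex.normSq_eq_conj_mul_self, Complex.normSq_eq_conj_mul_self]
    change star (v 1) * v 1 = star (u 0) * u 0
    linear_combination (-(v 1 * star (v 1))) * hu + u 0 * star (u 0) * hv +
      u 1 * star (v 1) * huv - star (u 0) * v 0 * huv'
  · linear_combination (-(star (v 0) * v 1)) * hu - star (u 0) * u 1 * hv +
      u 1 * star (v 0) * huv + star (u 0) * v 1 * huv'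

/-- The Bloch vector of a unit vector does not vanish. -/
lemma bloch_ne_zero {u : Fin 2 → ℂ} (hu : star u ⬝ᵥ u = 1)
    (h : Complex.normSq (u 0) = Complex.normSq (u 1)) : star (u 0) * u 1 ≠ 0 := by
  intro h0
  have h1 : u 0 = 0 ∧ u 1 = 0 := by
    rcases mul_eq_zero.mp h0 with h2 | h2
    · rw [star_eq_zero] at h2
      exact ⟨h2, by simpa [h2] using h.symm⟩
    · exact ⟨by simpa [h2] using h, h2⟩
  simp [dotProduct, Fin.sum_univ_two, h1.1, h1.2] at hu

/-- Of two orthogonal unit vectors of `ℂ^2` exactly one has a positive Bloch vector. -/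
lemma blochPos_iff_not {u v : Fin 2 → ℂ} (hu : star u ⬝ᵥ u = 1) (hv : star v ⬝ᵥ v = 1)
    (huv : star u ⬝ᵥ v = 0) : BlochPos v ↔ ¬ BlochPos u := by
  obtain ⟨h0, h1, h2⟩ := bloch_antipodal hu hv huv
  have hne : Complex.normSq (u 0) = Complex.normSq (u 1) →
      ¬((star (u 0) * u 1).re = 0 ∧ (star (u 0) * u 1).im = 0) :=
    fun h hz => bloch_ne_zero hu h (Complex.ext hz.1 hz.2)
  unfold BlochPos
  rw [h0, h1, h2, Complex.neg_re, Complex.neg_im]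
  generalize Complex.normSq (u 0) = p at *
  generalize Complex.normSq (u 1) = q at *
  generalize (star (u 0) * u 1).re = r at *
  generalize (star (u 0) * u 1).im = s at *
  grind

/-- There are no KS sets in dimension 2: every finite set of unit vectors in
`ℂ^2` admits a KS assignment. -/
theorem statement17
    (S : Finset (Fin 2 → ℂ))
    (hunit : ∀ x ∈ S, star x ⬝ᵥ x = (1 : ℂ)) :
    ∃ f : (Fin 2 → ℂ) → ℕ, IsKSAssignment2 S f := by
  classical
  refine ⟨fun x => if BlochPos x then 1 else 0, fun u _ => ?_, fun u hu w hw h => ?_,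
    fun b hb h => ?_⟩
  · by_cases hx : BlochPos u <;> simp [hx]
  · have := blochPos_iff_not (hunit u hu) (hunit w hw) h
    by_cases hx : BlochPos u <;> simp [hx, this]
  · have := blochPos_iff_not (hunit _ (hb 0)) (hunit _ (hb 1)) (h 0 1 (by decide))
    by_cases hx : BlochPos (b 0)
    · exact ⟨0, by simp [hx]⟩
    · exact ⟨1, by simp [this, hx]⟩
end
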